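/- arXiv:2010.11556 — 6 statements merged into one kernel-verified Lean document; each statement's English description precedes it below -/
import Mathlib

section
/- Let k ≥ 1 be a natural number, let f : ℝ → ℝ be k-times continuously differentiable, and let T ⊆ ℝ be a compact set such that the j-th derivative f^{(j)} vanishes at every point of T for every j with 1 ≤ j ≤ k. Then |f(x₁) − f(x₂)| = o(|x₁ − x₂|^k) uniformly for x₁, x₂ ∈ T; that is, for every ε > 0 there exists δ > 0 such that for all x₁, x₂ ∈ T with |x₁ − x₂| ≤ δ one has |f(x₁) − f(x₂)| ≤ ε·|x₁ − x₂|^k. -/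
open Set

/-- Mean value inequality on the closed ball around `a` through `x`. -/
theorem abs_sub_le_of_abs_deriv_le_closedBall {f : ℝ → ℝ} (hf : Differentiable ℝ f) {a x D : ℝ}
    (hD : ∀ y ∈ Metric.closedBall a |x - a|, |deriv f y| ≤ D) :
    |f x - f a| ≤ D * |x - a| :=
  (convex_closedBall a |x - a|).norm_image_sub_le_of_norm_deriv_le
    (fun y _ ↦ hf y) hD (Metric.mem_closedBall_self (abs_nonneg _)) (by simp [Real.dist_eq])

/-- If the derivatives of orders `1, …, n` of `f` vanish at `a` and the derivative of order `n + 1`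
is bounded by `C` on a closed ball around `a`, then `|f x - f a| ≤ C * |x - a| ^ (n + 1)` there. -/
theorem abs_sub_le_mul_pow_of_flat {n : ℕ} {f : ℝ → ℝ} (hf : ContDiff ℝ (n + 1 : ℕ) f)
    {a r C : ℝ} (hflat : ∀ j : ℕ, 1 ≤ j → j ≤ n → iteratedDeriv j f a = 0)
    (hC : ∀ y ∈ Metric.closedBall a r, |iteratedDeriv (n + 1) f y| ≤ C)
    {x : ℝ} (hx : x ∈ Metric.closedBall a r) :
    |f x - f a| ≤ C * |x - a| ^ (n + 1) := by
  induction n generalizing f x with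
  | zero =>
    simpa using abs_sub_le_of_abs_deriv_le_closedBall (hf.differentiable (by simp))
      fun y hy ↦ by simpa using hC y (Metric.closedBall_subset_closedBall hx hy)
  | succ n ih =>
    have hf' : ContDiff ℝ (n + 1 : ℕ) (deriv f) := by
      simpa using hf.iterate_deriv' (n + 1) 1
    have hfa : deriv f a = 0 := by simpa using hflat 1 le_rfl (by omega)
    have bound : ∀ y ∈ Metric.closedBall a |x - a|, |deriv f y| ≤ C * |x - a| ^ (n + 1) := by
      intro y hy
      have hyr := Metric.closedBall_subset_closedBall hx hy
      have hya : |y - a| ≤ |x - a| := hy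
      have hC0 : 0 ≤ C := (abs_nonneg _).trans (hC y hyr)
      have h := ih hf'
        (fun j _ hj ↦ by rw [← iteratedDeriv_succ']; exact hflat _ (by omega) (by omega))
        (fun z hz ↦ by rw [← iteratedDeriv_succ']; exact hC z hz) hyr
      rw [hfa, sub_zero] at h
      exact h.trans (by gcongr)
    calc |f x - f a| ≤ C * |x - a| ^ (n + 1) * |x - a| :=
          abs_sub_le_of_abs_deriv_le_closedBall (hf.differentiable (by simp)) bound
      _ = C * |x - a| ^ (n + 1 + 1) := by ring

/-- If `f` is `C^k` (`k ≥ 1`) and flat of order `k` at every point of a compact set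
`T` (all derivatives of orders `1, …, k` vanish on `T`), then
`|f x₁ - f x₂| = o(|x₁ - x₂|^k)` uniformly for `x₁, x₂ ∈ T`. -/
theorem abs_sub_isLittleO_of_flat_on_compact (k : ℕ) (hk : 1 ≤ k) (f : ℝ → ℝ)
    (hf : ContDiff ℝ k f) (T : Set ℝ) (hT : IsCompact T)
    (hflat : ∀ x ∈ T, ∀ j : ℕ, 1 ≤ j → j ≤ k → iteratedDeriv j f x = 0) :
    ∀ ε : ℝ, 0 < ε → ∃ δ : ℝ, 0 < δ ∧
      ∀ x₁ ∈ T, ∀ x₂ ∈ T, |x₁ - x₂| ≤ δ →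
        |f x₁ - f x₂| ≤ ε * |x₁ - x₂| ^ k := by
  intro ε hε
  obtain ⟨n, rfl⟩ := Nat.exists_eq_add_of_le' hk
  have hcont : Continuous (iteratedDeriv (n + 1) f) := hf.continuous_iteratedDeriv _ le_rfl
  obtain ⟨δ, hδ, hsmall⟩ := Metric.mem_uniformity_dist.1 <|
    hT.uniformContinuousAt_of_continuousAt _ (fun _ _ ↦ hcont.continuousAt)
      (Metric.dist_mem_uniformity hε)
  refine ⟨δ / 2, half_pos hδ, fun x₁ h₁ x₂ h₂ h ↦ ?_⟩
  refine abs_sub_le_mul_pow_of_flat hf (fun j hj hjn ↦ hflat x₂ h₂ j hj (by omega))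
    (fun y hy ↦ ?_) (r := δ / 2) h
  have hdist : dist x₂ y < δ := by
    rw [dist_comm]
    exact (Metric.mem_closedBall.1 hy).trans_lt (half_lt_self hδ)
  have hy' : dist (iteratedDeriv (n + 1) f x₂) (iteratedDeriv (n + 1) f y) < ε :=
    hsmall hdist h₂
  rw [hflat x₂ h₂ (n + 1) hk le_rfl, Real.dist_eq, zero_sub, abs_neg] at hy'
  exact hy'.le
end

section
/- Let k ≥ 1 be a natural number and let f : ℝ → ℝ be k-times continuously differentiable. Let T be the set of condensation points of the critical set {x ∈ ℝ : f'(x) = 0}. Then f is flat of order k at every point of T; that is, for every x ∈ T and every j with 1 ≤ j ≤ k, the j-th derivative f^{(j)}(x) = 0. -/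
open Set

open Filter Topology

/-- A continuous function with zeros accumulating at `x` vanishes at `x`. -/
theorem Continuous.eq_zero_of_frequently_nhdsNE {g : ℝ → ℝ} (hg : Continuous g) {x : ℝ}
    (h : ∃ᶠ z in 𝓝[≠] x, g z = 0) : g x = 0 :=
  (isClosed_eq hg continuous_const).mem_of_frequently_of_tendsto h
    (tendsto_id.mono_left nhdsWithin_le_nhds)

/-- By Rolle's theorem, if the zeros of a continuous function accumulate at `x`, then so do the
zeros of its derivative. -/
theorem Continuous.frequently_deriv_eq_zero {g : ℝ → ℝ} (hg : Continuous g) {x : ℝ}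
    (h : ∃ᶠ z in 𝓝[≠] x, g z = 0) : ∃ᶠ z in 𝓝[≠] x, deriv g z = 0 := by
  have hgx := hg.eq_zero_of_frequently_nhdsNE h
  rw [frequently_iff]
  intro U hU
  obtain ⟨ε, hε, hεU⟩ := Metric.mem_nhdsWithin_iff.mp hU
  obtain ⟨z, hz, hgz⟩ := frequently_iff.mp h
    (inter_mem_nhdsWithin {x}ᶜ (Metric.ball_mem_nhds x hε))
  have hzε := abs_lt.mp (Real.dist_eq z x ▸ Metric.mem_ball.mp hz.2)
  rcases lt_or_gt_of_ne hz.1 with hlt | hlt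
  · obtain ⟨c, hc, hgc⟩ := exists_deriv_eq_zero hlt hg.continuousOn (hgz.trans hgx.symm)
    refine ⟨c, hεU ⟨?_, hc.2.ne⟩, hgc⟩
    rw [Metric.mem_ball, Real.dist_eq, abs_lt]
    constructor <;> linarith [hc.1, hc.2]
  · obtain ⟨c, hc, hgc⟩ := exists_deriv_eq_zero hlt hg.continuousOn (hgx.trans hgz.symm)
    refine ⟨c, hεU ⟨?_, hc.1.ne'⟩, hgc⟩
    rw [Metric.mem_ball, Real.dist_eq, abs_lt]
    constructor <;> linarith [hc.1, hc.2]

/-- A `C^k` function (`k ≥ 1`) is flat of order `k` at every condensation point of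
its critical set: if every neighbourhood of `x` contains uncountably many critical
points of `f`, then all derivatives of `f` of orders `1, …, k` vanish at `x`. -/
theorem iteratedDeriv_eq_zero_of_condensation_of_critical (k : ℕ) (hk : 1 ≤ k)
    (f : ℝ → ℝ) (hf : ContDiff ℝ k f) (x : ℝ)
    (hx : ∀ U : Set ℝ, IsOpen U → x ∈ U →
      ¬ (U ∩ {z : ℝ | deriv f z = 0}).Countable) :
    ∀ j : ℕ, 1 ≤ j → j ≤ k → iteratedDeriv j f x = 0 := by
  have hacc : ∃ᶠ z in 𝓝[≠] x, deriv f z = 0 := by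
    rw [frequently_iff]
    intro U hU
    obtain ⟨V, hV, hxV, hVU⟩ := mem_nhdsWithin.mp hU
    by_contra! hne
    refine hx V hV hxV ((countable_singleton x).mono ?_)
    rintro z ⟨hzV, hz⟩
    by_contra hzx
    exact hne z (hVU ⟨hzV, hzx⟩) hz
  have hcont (j : ℕ) (hjk : j ≤ k) : Continuous (iteratedDeriv j f) :=
    hf.continuous_iteratedDeriv j (by exact_mod_cast hjk)
  have hfreq (j : ℕ) (hj : 1 ≤ j) : j ≤ k → ∃ᶠ z in 𝓝[≠] x, iteratedDeriv j f z = 0 := by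
    induction j, hj using Nat.le_induction with
    | base => intro _; rwa [iteratedDeriv_one]
    | succ n _ ih =>
      intro hnk
      rw [iteratedDeriv_succ]
      exact (hcont n (by omega)).frequently_deriv_eq_zero (ih (by omega))
  exact fun j hj hjk => (hcont j hjk).eq_zero_of_frequently_nhdsNE (hfreq j hj hjk)
end

section
/- Let k ≥ 1 be a natural number, let E ⊆ ℝ be an interval, and let f ∈ C^k(E,ℝ). Then the set I_u(f) := {y ∈ ℝ : f⁻¹(y) is uncountable} has Hausdorff dimension at most 1/k. -/
open MeasureTheory Set ENNReal

/-- A level set of a function contains only countably many points at which the derivative within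
the domain does not vanish. -/
theorem countable_setOf_eq_and_hasDerivWithinAt_ne_zero {s : Set ℝ} {f f' : ℝ → ℝ} (c : ℝ)
    (hf : ∀ x ∈ s, HasDerivWithinAt f (f' x) s x) :
    {x ∈ s | f x = c ∧ f' x ≠ 0}.Countable := by
  refine (HereditarilyLindelofSpace.isLindelof _).countable_of_isDiscrete ?_
  rw [isDiscrete_iff_nhdsNE]
  rintro x ⟨hxs, -, hx⟩
  have h := (hf x hxs).eventually_ne (c := c) hx
  rw [← Filter.empty_mem_iff_bot, ← nhdsWithin_inter']
  rw [eventually_nhdsWithin_iff] at h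
  rw [mem_nhdsWithin_iff_eventually]
  filter_upwards [h] with z hz hz'
  exact hz ⟨hz'.2.1, hz'.1⟩ hz'.2.2.1

/-- If the iterated derivatives `F 1, …, F k` of `F 0` vanish at `x` and `F k` is bounded by `C` on
a convex set, then `F 0` deviates from its value at `x` by at most `C * |z - x| ^ k`. -/
theorem abs_sub_le_mul_pow_of_iterated_hasDerivWithinAt {s t : Set ℝ} (hts : t ⊆ s)
    (ht : Convex ℝ t) {k : ℕ} {F : ℕ → ℝ → ℝ}
    (hF : ∀ j < k, ∀ x ∈ s, HasDerivWithinAt (F j) (F (j + 1) x) s x) {C : ℝ} {x : ℝ}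
    (hx : x ∈ t) (hx0 : ∀ j < k, F (j + 1) x = 0) (hC : ∀ z ∈ t, |F k z - F k x| ≤ C)
    {z : ℝ} (hz : z ∈ t) : |F 0 z - F 0 x| ≤ C * |z - x| ^ k := by
  have hC0 : 0 ≤ C := (abs_nonneg _).trans (hC x hx)
  suffices H : ∀ m ≤ k, ∀ z ∈ t, |F (k - m) z - F (k - m) x| ≤ C * |z - x| ^ m by
    simpa using H k le_rfl z hz
  intro m
  induction m with
  | zero => simpa using hC
  | succ m ih =>
    intro hm z hz
    have hj : k - (m + 1) < k := by omega
    have hj' : k - (m + 1) + 1 = k - m := by omega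
    have hsub : segment ℝ x z ⊆ t := ht.segment_subset hx hz
    have key := Convex.norm_image_sub_le_of_norm_hasDerivWithin_le
      (fun w hw ↦ (hF _ hj w (hts (hsub hw))).mono (hsub.trans hts))
      (C := C * |z - x| ^ m) ?_ (convex_segment x z) (left_mem_segment ℝ x z)
      (right_mem_segment ℝ x z)
    · simpa [Real.norm_eq_abs, pow_succ, mul_assoc] using key
    · intro w hw
      have h1 := ih (by omega) w (hsub hw)
      rw [← hj', hx0 _ hj, sub_zero] at h1
      refine h1.trans ?_
      have h2 : |w - x| ≤ |z - x| := by
        rw [segment_eq_uIcc] at hw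
        exact abs_sub_left_of_mem_uIcc hw
      gcongr

/-- The image of the set of points where the first `k` derivatives of a `C^k` function vanish has
Hausdorff dimension at most `1 / k`. -/
theorem dimH_image_setOf_iteratedDerivWithin_eq_zero_le {k : ℕ} (hk : 1 ≤ k) {s : Set ℝ}
    (hs : Convex ℝ s) (hu : UniqueDiffOn ℝ s) {f : ℝ → ℝ} (hf : ContDiffOn ℝ k f s) :
    dimH (f '' {x ∈ s | ∀ j < k, iteratedDerivWithin (j + 1) f s x = 0}) ≤ 1 / (k : ℝ≥0∞) := by
  set A := {x ∈ s | ∀ j < k, iteratedDerivWithin (j + 1) f s x = 0}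
  have hA0 : ∀ x ∈ A, iteratedDerivWithin k f s x = 0 := fun x hx ↦ by
    simpa [Nat.sub_add_cancel hk] using hx.2 (k - 1) (by omega)
  have hF : ∀ j < k, ∀ x ∈ s, HasDerivWithinAt (iteratedDerivWithin j f s)
      (iteratedDerivWithin (j + 1) f s x) s x := fun j hj x hx ↦ by
    rw [iteratedDerivWithin_succ]
    exact (hf.differentiableOn_iteratedDerivWithin (mod_cast hj) hu x hx).hasDerivWithinAt
  have hle : dimH (f '' A) ≤ dimH A / ((k : NNReal) : ℝ≥0∞) := by
    refine dimH_image_le_of_locally_holder_on (by exact_mod_cast hk) fun x hx ↦ ?_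
    have hcont := hf.continuousOn_iteratedDerivWithin le_rfl hu x hx.1
    obtain ⟨ε, hε, hb⟩ := Metric.continuousWithinAt_iff.1 hcont 1 one_pos
    refine ⟨1, Metric.ball x ε ∩ A,
      Filter.inter_mem (mem_nhdsWithin_of_mem_nhds (Metric.ball_mem_nhds x hε))
        self_mem_nhdsWithin, ?_⟩
    rintro y ⟨hyb, hy⟩ z ⟨hzb, hz⟩
    have hbound := abs_sub_le_mul_pow_of_iterated_hasDerivWithinAt (t := s ∩ Metric.ball x ε)
      (F := fun j ↦ iteratedDerivWithin j f s) (C := 1)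
      inter_subset_left (hs.inter (convex_ball x ε)) hF ⟨hz.1, hzb⟩ hz.2
      (fun w hw ↦ ?_) ⟨hy.1, hyb⟩
    · simp only [iteratedDerivWithin_zero, one_mul] at hbound
      rw [ENNReal.coe_one, one_mul, NNReal.coe_natCast, ENNReal.rpow_natCast, edist_dist,
        edist_dist, ← ENNReal.ofReal_pow dist_nonneg]
      exact ENNReal.ofReal_le_ofReal hbound
    · have h := hb hw.1 hw.2
      rw [Real.dist_eq, hA0 x hx] at h
      simpa [hA0 z hz] using h.le
  refine hle.trans ?_
  rw [ENNReal.coe_natCast]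
  gcongr
  exact (dimH_mono (subset_univ A)).trans Real.dimH_univ.le

/-- For a `C^k` function (`k ≥ 1`) on an interval `E ⊆ ℝ`, the set
`I_u(f)` of values `y` whose level set `f⁻¹(y)` is uncountable has Hausdorff
dimension at most `1/k`. -/
theorem dimH_uncountable_level_values_le (k : ℕ) (hk : 1 ≤ k) (E : Set ℝ)
    (hE : E.OrdConnected) (f : ℝ → ℝ) (hf : ContDiffOn ℝ k f E) :
    dimH {y : ℝ | ¬ (E ∩ f ⁻¹' {y}).Countable} ≤ 1 / (k : ℝ≥0∞) := by
  rcases E.subsingleton_or_nontrivial with hsub | hnt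
  · have : {y : ℝ | ¬ (E ∩ f ⁻¹' {y}).Countable} = ∅ :=
      eq_empty_of_forall_notMem fun y hy ↦ hy (hsub.countable.mono inter_subset_left)
    simp [this]
  have hu : UniqueDiffOn ℝ E :=
    uniqueDiffOn_convex hE.convex (hE.convex.nontrivial_iff_nonempty_interior.1 hnt)
  refine (dimH_mono fun y hy ↦ ?_).trans
    (dimH_image_setOf_iteratedDerivWithin_eq_zero_le hk hE.convex hu hf)
  by_contra hyA
  refine hy (Countable.mono (s₂ := ⋃ j ∈ Iio k, {x ∈ E | iteratedDerivWithin j f E x =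
    (if j = 0 then y else 0) ∧ iteratedDerivWithin (j + 1) f E x ≠ 0}) ?_ ?_)
  · rintro x ⟨hxE, hxy⟩
    have hex : ∃ j, j < k ∧ iteratedDerivWithin (j + 1) f E x ≠ 0 := by
      by_contra! h
      exact hyA ⟨x, ⟨hxE, h⟩, hxy⟩
    classical
    obtain ⟨hj, hne⟩ := Nat.find_spec hex
    refine mem_biUnion (mem_Iio.2 hj) ⟨hxE, ?_, hne⟩
    have hmin := fun m ↦ Nat.find_min hex (m := m)
    generalize Nat.find hex = n at hj hne hmin ⊢
    rcases n with _ | m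
    · simpa using hxy
    · have := hmin m (Nat.lt_succ_self m)
      push Not at this
      simpa using this (by omega)
  · refine (to_countable _).biUnion fun j hj ↦
      countable_setOf_eq_and_hasDerivWithinAt_ne_zero _ fun x hx ↦ ?_
    rw [iteratedDerivWithin_succ]
    exact (hf.differentiableOn_iteratedDerivWithin (mod_cast hj) hu x hx).hasDerivWithinAt
end

section
/- Let k ≥ 1 be a natural number, let E ⊆ ℝ be a nonempty open interval, and let f ∈ C^k(E,ℝ). Then L(1,f) = 0; that is, the set {y ∈ ℝ : dim_H f⁻¹(y) ≥ 1} has Hausdorff dimension 0. Consequently sup{ L(1,f) : f ∈ C^k(E,ℝ) } = 0 = (1−1)/k, so the formula of the main theorem also holds at α = 1. -/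
open MeasureTheory Set

open Filter Topology NNReal ENNReal

lemma LipschitzOnWith.isBounded_image {X Y : Type*} [PseudoMetricSpace X] [PseudoMetricSpace Y]
    {f : X → Y} {K : ℝ≥0} {s : Set X} (hf : LipschitzOnWith K f s) (hs : Bornology.IsBounded s) :
    Bornology.IsBounded (f '' s) := by
  obtain ⟨R, hR⟩ := Metric.isBounded_iff.1 hs
  refine Metric.isBounded_iff.2 ⟨K * R, ?_⟩
  rintro _ ⟨x, hx, rfl⟩ _ ⟨y, hy, rfl⟩
  exact (hf.dist_le_mul x hx y hy).trans (by gcongr; exact hR hx hy)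

/-- The integers `i` such that the cell `[i / n, (i + 1) / n)` meets `s`. -/
def gridCells (n : ℕ) (s : Set ℝ) : Set ℤ := (fun x : ℝ => ⌊n * x⌋) '' s

lemma gridCells_subset_Icc {s : Set ℝ} {B : ℕ} (hs : s ⊆ Icc (-B : ℝ) B) (n : ℕ) :
    gridCells n s ⊆ Icc (-(n * B : ℤ)) (n * B) := by
  rintro _ ⟨x, hx, rfl⟩
  obtain ⟨h₁, h₂⟩ := hs hx
  have hn : (0 : ℝ) ≤ n := n.cast_nonneg
  constructor
  · rw [Int.le_floor]
    push_cast
    nlinarith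
  · have h : (n * x : ℝ) < ((n * B : ℤ) : ℝ) + 1 := by
      push_cast
      nlinarith
    exact Int.floor_le_iff.2 h

lemma exists_subset_Icc_of_isBounded {s : Set ℝ} (hs : Bornology.IsBounded s) :
    ∃ B : ℕ, s ⊆ Icc (-B : ℝ) B := by
  obtain ⟨R, hR⟩ := hs.subset_closedBall 0
  obtain ⟨B, hB⟩ := exists_nat_ge R
  refine ⟨B, fun x hx => ?_⟩
  have := hR hx
  rw [Metric.mem_closedBall, Real.dist_eq, sub_zero, abs_le] at this
  constructor <;> linarith [this.1, this.2]

lemma finite_gridCells {s : Set ℝ} (hs : Bornology.IsBounded s) (n : ℕ) :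
    (gridCells n s).Finite := by
  obtain ⟨B, hB⟩ := exists_subset_Icc_of_isBounded hs
  exact (finite_Icc _ _).subset (gridCells_subset_Icc hB n)

lemma exists_ncard_gridCells_le {s : Set ℝ} (hs : Bornology.IsBounded s) :
    ∃ C : ℕ, ∀ n : ℕ, 1 ≤ n → (gridCells n s).ncard ≤ C * n := by
  obtain ⟨B, hB⟩ := exists_subset_Icc_of_isBounded hs
  refine ⟨2 * B + 1, fun n hn => ?_⟩
  refine (ncard_le_ncard (gridCells_subset_Icc hB n) (finite_Icc _ _)).trans ?_
  rw [← Finset.coe_Icc, ncard_coe_finset, Int.card_Icc]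
  have hnB : (0 : ℤ) ≤ n * B := by positivity
  zify at hn ⊢
  rw [Int.toNat_of_nonneg (by linarith)]
  linarith

lemma hausdorffMeasure_le_of_frequently_ncard_gridCells_le {s : Set ℝ}
    (hs : Bornology.IsBounded s) {d : ℝ} (hd : 0 ≤ d) {C : ℝ}
    (h : ∃ᶠ n : ℕ in atTop, ((gridCells n s).ncard : ℝ) ≤ C * (n : ℝ) ^ d) :
    μH[d] s ≤ ENNReal.ofReal C := by
  have hdiam : ∀ᶠ n : ℕ in atTop, ∀ i : gridCells n s,
      Metric.ediam {x : ℝ | ⌊n * x⌋ = i} ≤ ENNReal.ofReal (1 / n) := by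
    filter_upwards [eventually_ge_atTop 1] with n hn i
    refine Metric.ediam_le fun x hx y hy => ?_
    rw [edist_dist]
    refine ENNReal.ofReal_le_ofReal ?_
    have hn' : (0 : ℝ) < n := by exact_mod_cast hn
    have := Int.abs_sub_lt_one_of_floor_eq_floor (hx.trans hy.symm)
    rw [← mul_sub, abs_mul, abs_of_pos hn'] at this
    rw [Real.dist_eq, le_div_iff₀ hn']
    linarith
  refine (Measure.hausdorffMeasure_le_liminf_tsum (l := atTop) d s
    (fun n : ℕ => ENNReal.ofReal (1 / n)) ?_
    (fun n (i : gridCells n s) => {x : ℝ | ⌊n * x⌋ = i}) hdiam ?_).trans ?_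
  · simpa using ENNReal.tendsto_ofReal tendsto_one_div_atTop_nhds_zero_nat
  · exact Eventually.of_forall fun n x hx =>
      mem_iUnion.2 ⟨⟨⌊n * x⌋, x, hx, rfl⟩, rfl⟩
  · refine liminf_le_of_frequently_le' ?_
    refine (h.and_eventually (hdiam.and (eventually_ge_atTop 1))).mono ?_
    rintro n ⟨hcard, hn, hn1⟩
    have hn' : (0 : ℝ) < n := by exact_mod_cast hn1
    calc ∑' i : gridCells n s, Metric.ediam {x : ℝ | ⌊n * x⌋ = i} ^ d
        ≤ ∑' _ : gridCells n s, ENNReal.ofReal (1 / n) ^ d :=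
          ENNReal.tsum_le_tsum fun i => ENNReal.rpow_le_rpow (hn i) hd
      _ = ENNReal.ofReal ((gridCells n s).ncard * (1 / n) ^ d) := by
          rw [ENNReal.tsum_const, ENat.card_coe_set_eq, ← (finite_gridCells hs n).cast_ncard_eq,
            ENNReal.ofReal_mul (by positivity), ENNReal.ofReal_rpow_of_nonneg (by positivity) hd]
          simp
      _ ≤ ENNReal.ofReal C := by
          refine ENNReal.ofReal_le_ofReal ?_
          rw [Real.div_rpow zero_le_one hn'.le, Real.one_rpow, mul_one_div,
            div_le_iff₀ (by positivity)]
          exact hcard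

lemma ncard_gridCells_mul_le {f : ℝ → ℝ} {K : ℕ} {s W : Set ℝ} {n m : ℕ}
    (hf : LipschitzOnWith K f s) (hs : Bornology.IsBounded s) (hW : W ⊆ f '' s)
    (hm : ∀ y ∈ W, m ≤ (gridCells n (s ∩ f ⁻¹' {y})).ncard) :
    (gridCells n W).ncard * m ≤ (gridCells n s).ncard * (2 * K + 1) := by
  classical
  have hWfin : (gridCells n W).Finite :=
    finite_gridCells ((hf.isBounded_image hs).subset hW) n
  have hsfin := finite_gridCells hs n
  rw [ncard_eq_toFinset_card _ hWfin, ncard_eq_toFinset_card _ hsfin]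
  refine Finset.card_mul_le_card_mul
    (fun j i : ℤ => ∃ x ∈ s, ⌊n * x⌋ = i ∧ ⌊n * f x⌋ = j) ?_ ?_
  · intro j hj
    obtain ⟨y, hy, rfl⟩ := hWfin.mem_toFinset.1 hj
    refine (hm y hy).trans ?_
    rw [← ncard_coe_finset]
    refine ncard_le_ncard ?_ (Finset.finite_toSet _)
    rintro _ ⟨x, ⟨hxs, hxy⟩, rfl⟩
    rw [Finset.mem_coe, Finset.mem_bipartiteAbove, hsfin.mem_toFinset]
    exact ⟨⟨x, hxs, rfl⟩, x, hxs, rfl, by rw [show f x = y from hxy]⟩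
  · intro i hi
    obtain ⟨z, hz, rfl⟩ := hsfin.mem_toFinset.1 hi
    have hsub : (hWfin.toFinset).bipartiteBelow
        (fun j i : ℤ => ∃ x ∈ s, ⌊n * x⌋ = i ∧ ⌊n * f x⌋ = j) ⌊n * z⌋ ⊆
        Finset.Icc (⌊n * f z⌋ - K) (⌊n * f z⌋ + K) := by
      intro j hj
      obtain ⟨-, x, hx, hxz, rfl⟩ := (Finset.mem_bipartiteBelow _).1 hj
      have h₁ : |n * x - n * z| < 1 := Int.abs_sub_lt_one_of_floor_eq_floor hxz
      have h₂ := hf.dist_le_mul x hx z hz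
      have hn : (0 : ℝ) ≤ n := n.cast_nonneg
      have hK : (0 : ℝ) ≤ K := K.cast_nonneg
      rw [← mul_sub, abs_mul, abs_of_nonneg hn] at h₁
      rw [Real.dist_eq, Real.dist_eq] at h₂
      have h₃ : |n * f x - n * f z| ≤ K := by
        rw [← mul_sub, abs_mul, abs_of_nonneg hn]
        calc (n : ℝ) * |f x - f z| ≤ n * (K * |x - z|) := by
              gcongr
              simpa using h₂
          _ = K * (n * |x - z|) := by ring
          _ ≤ K * 1 := by gcongr
          _ = K := mul_one _
      rw [abs_le] at h₃
      have hx₁ := Int.floor_le (n * f x)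
      have hx₂ := Int.lt_floor_add_one (n * f x)
      have hz₁ := Int.floor_le (n * f z)
      have hz₂ := Int.lt_floor_add_one (n * f z)
      rw [Finset.mem_Icc]
      constructor
      · have : ((⌊n * f z⌋ - K : ℤ) : ℝ) < ((⌊n * f x⌋ + 1 : ℤ) : ℝ) := by
          push_cast
          linarith
        have := Int.cast_lt.1 this
        lia
      · have : ((⌊n * f x⌋ : ℤ) : ℝ) < ((⌊n * f z⌋ + K + 1 : ℤ) : ℝ) := by
          push_cast
          linarith
        have := Int.cast_lt.1 this
        lia
    refine (Finset.card_le_card hsub).trans ?_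
    rw [Int.card_Icc]
    lia

/-- For a Lipschitz function on a bounded subset of the line, the set of values whose fibre has
dimension more than `α` has dimension at most `1 - α`. -/
lemma LipschitzOnWith.dimH_setOf_lt_dimH_fiber_le {f : ℝ → ℝ} {K : ℝ≥0} {s : Set ℝ}
    (hf : LipschitzOnWith K f s) (hs : Bornology.IsBounded s) {α : ℝ≥0} (hα : α ≤ 1) :
    dimH {y : ℝ | (α : ℝ≥0∞) < dimH (s ∩ f ⁻¹' {y})} ≤ (1 - α : ℝ≥0) := by
  obtain ⟨L, hL⟩ := exists_nat_ge K
  replace hf : LipschitzOnWith (L : ℝ≥0) f s := hf.weaken hL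
  obtain ⟨C, hC⟩ := exists_ncard_gridCells_le hs
  set W : ℕ → Set ℝ := fun m => {y | y ∈ f '' s ∧
    ∀ n ≥ m, ⌈(n : ℝ) ^ (α : ℝ)⌉₊ ≤ (gridCells n (s ∩ f ⁻¹' {y})).ncard}
  have hsub : {y : ℝ | (α : ℝ≥0∞) < dimH (s ∩ f ⁻¹' {y})} ⊆ ⋃ m, W m := by
    intro y hy
    have htop : μH[(α : ℝ)] (s ∩ f ⁻¹' {y}) = ∞ := hausdorffMeasure_of_lt_dimH hy
    have hev : ∀ᶠ n : ℕ in atTop,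
        ¬ ((gridCells n (s ∩ f ⁻¹' {y})).ncard : ℝ) ≤ 1 * (n : ℝ) ^ (α : ℝ) := by
      rw [← not_frequently]
      intro h
      have := hausdorffMeasure_le_of_frequently_ncard_gridCells_le
        (hs.subset inter_subset_left) α.coe_nonneg h
      rw [htop] at this
      exact ENNReal.ofReal_ne_top (top_le_iff.1 this)
    obtain ⟨m, hm⟩ := eventually_atTop.1 hev
    refine mem_iUnion.2 ⟨m, ?_, fun n hn => ?_⟩
    · have hne : (s ∩ f ⁻¹' {y}).Nonempty := by
        by_contra h
        rw [not_nonempty_iff_eq_empty] at h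
        simp [h] at htop
      obtain ⟨x, hx, hxy⟩ := hne
      exact ⟨x, hx, hxy⟩
    · have := hm n hn
      rw [one_mul, not_le] at this
      exact Nat.ceil_le.2 this.le
  refine (dimH_mono hsub).trans ?_
  rw [dimH_iUnion]
  refine iSup_le fun m => dimH_le_of_hausdorffMeasure_ne_top (ne_top_of_le_ne_top
    (ENNReal.ofReal_ne_top (r := C * (2 * L + 1))) ?_)
  refine hausdorffMeasure_le_of_frequently_ncard_gridCells_le
    ((hf.isBounded_image hs).subset fun y hy => hy.1) (NNReal.coe_nonneg _) ?_
  refine Eventually.frequently ?_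
  filter_upwards [eventually_ge_atTop m, eventually_ge_atTop 1] with n hnm hn
  have hn' : (0 : ℝ) < n := by exact_mod_cast hn
  have h := ncard_gridCells_mul_le (n := n) hf hs (fun y (hy : y ∈ W m) => hy.1)
    (fun y hy => hy.2 n hnm)
  have h₁ : (((gridCells n (W m)).ncard : ℝ)) * (n : ℝ) ^ (α : ℝ) ≤ C * n * (2 * L + 1) := by
    calc ((gridCells n (W m)).ncard : ℝ) * (n : ℝ) ^ (α : ℝ)
        ≤ (gridCells n (W m)).ncard * ⌈(n : ℝ) ^ (α : ℝ)⌉₊ := by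
          gcongr
          exact Nat.le_ceil _
      _ ≤ (gridCells n s).ncard * (2 * L + 1) := by exact_mod_cast h
      _ ≤ C * n * (2 * L + 1) := by
          gcongr
          exact_mod_cast hC n hn
  rw [NNReal.coe_sub hα, NNReal.coe_one, Real.rpow_sub hn', Real.rpow_one, ← mul_div_assoc,
    le_div_iff₀ (by positivity)]
  linarith

lemma dimH_setOf_one_le_dimH_fiber_eq_zero {f : ℝ → ℝ} {U : Set ℝ}
    (hf : ∀ x ∈ U, ∃ K, ∃ t ∈ 𝓝 x, LipschitzOnWith K f t) :
    dimH {y : ℝ | 1 ≤ dimH (U ∩ f ⁻¹' {y})} = 0 := by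
  have hloc : ∀ x ∈ U, ∃ t ∈ 𝓝[U] x, Bornology.IsBounded t ∧ ∃ K, LipschitzOnWith K f t := by
    intro x hx
    obtain ⟨K, t, ht, hK⟩ := hf x hx
    exact ⟨t ∩ Metric.ball x 1,
      mem_nhdsWithin_of_mem_nhds (inter_mem ht (Metric.ball_mem_nhds x one_pos)),
      Metric.isBounded_ball.subset inter_subset_right, K, hK.mono inter_subset_left⟩
  choose! t ht hbdd K hK using hloc
  obtain ⟨c, hcU, hc, hcover⟩ := TopologicalSpace.countable_cover_nhdsWithin ht
  have key : ∀ α : ℝ≥0, α < 1 → dimH {y : ℝ | 1 ≤ dimH (U ∩ f ⁻¹' {y})} ≤ (1 - α : ℝ≥0) := by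
    intro α hα
    have hsub : {y : ℝ | 1 ≤ dimH (U ∩ f ⁻¹' {y})} ⊆
        ⋃ x ∈ c, {y : ℝ | (α : ℝ≥0∞) < dimH (t x ∩ f ⁻¹' {y})} := by
      intro y hy
      have h₁ : (α : ℝ≥0∞) < dimH (⋃ x ∈ c, t x ∩ f ⁻¹' {y}) := by
        refine (ENNReal.coe_lt_one_iff.2 hα).trans_le (hy.trans (dimH_mono ?_))
        rw [← iUnion₂_inter]
        exact inter_subset_inter_left _ hcover
      rw [dimH_bUnion hc] at h₁
      simpa only [lt_iSup_iff, mem_iUnion, mem_ofPred_eq] using h₁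
    refine (dimH_mono hsub).trans ?_
    rw [dimH_bUnion hc]
    exact iSup₂_le fun x hx =>
      (hK x (hcU hx)).dimH_setOf_lt_dimH_fiber_le (hbdd x (hcU hx)) hα.le
  refine le_antisymm (ENNReal.le_of_forall_pos_le_add fun ε hε _ => ?_) zero_le
  rw [zero_add]
  refine (key (1 - ε) (tsub_lt_self one_pos hε)).trans ?_
  exact ENNReal.coe_le_coe.2 tsub_tsub_le

/-- For a `C^k` function (`k ≥ 1`) on a nonempty open interval `E = Ioo a b`, the set
of values `y` whose level set has Hausdorff dimension at least `1` is itself of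
Hausdorff dimension `0`; consequently the supremum of `L(1, f)` over all `C^k`
functions equals `0 = (1 - 1)/k`, so the main theorem also holds at `α = 1`. -/
theorem dimH_full_dim_level_values_eq_zero (k : ℕ) (hk : 1 ≤ k) (a b : ℝ)
    (hab : a < b) :
    (∀ f : ℝ → ℝ, ContDiffOn ℝ k f (Set.Ioo a b) →
        dimH {y : ℝ | 1 ≤ dimH (Set.Ioo a b ∩ f ⁻¹' {y})} = 0) ∧
      (⨆ (f : ℝ → ℝ) (_ : ContDiffOn ℝ k f (Set.Ioo a b)),
          dimH {y : ℝ | 1 ≤ dimH (Set.Ioo a b ∩ f ⁻¹' {y})}) =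
        ENNReal.ofReal ((1 - 1) / k) := by
  have main : ∀ f : ℝ → ℝ, ContDiffOn ℝ k f (Set.Ioo a b) →
      dimH {y : ℝ | 1 ≤ dimH (Set.Ioo a b ∩ f ⁻¹' {y})} = 0 := fun f hf =>
    dimH_setOf_one_le_dimH_fiber_eq_zero fun x hx =>
      ((hf.contDiffAt (Ioo_mem_nhds hx.1 hx.2)).of_le
        (by exact_mod_cast hk)).exists_lipschitzOnWith
  refine ⟨main, ?_⟩
  rw [sub_self, zero_div, ENNReal.ofReal_zero, ← nonpos_iff_eq_zero]
  exact iSup₂_le fun f hf => (main f hf).le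
end

section
/- Let k ≥ 1 be a natural number. For every η > 0 there exists a k-times continuously differentiable function f : (-2,2) → ℝ whose critical set A := {x ∈ (-2,2) : f'(x) = 0} satisfies dim_H f(A) > 1/k − η. In other words, the Hausdorff dimension of the image of the critical set of a C^k function on an interval may be arbitrarily close to 1/k. -/
open MeasureTheory Set

/-- The value `∑ aₙ rⁿ` at `r` of the power series with coefficients the digits `aₙ < N`. -/
noncomputable def digitSeries {N : ℕ} (r : ℝ) (a : ℕ → Fin N) : ℝ :=
  ∑' n, r ^ n * ((a n : ℕ) : ℝ)

section DigitSeries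

variable {N : ℕ} {r : ℝ}

lemma digit_le (d : Fin N) : ((d : ℕ) : ℝ) ≤ N - 1 := by
  have h : (d : ℕ) + 1 ≤ N := d.2
  have : (((d : ℕ) + 1 : ℕ) : ℝ) ≤ N := by exact_mod_cast h
  push_cast at this
  linarith

lemma summable_digitSeries (hr0 : 0 ≤ r) (hr1 : r < 1) (a : ℕ → Fin N) :
    Summable fun n => r ^ n * ((a n : ℕ) : ℝ) :=
  Summable.of_nonneg_of_le (fun n => by positivity)
    (fun n => mul_le_mul_of_nonneg_left (digit_le (a n)) (by positivity))
    ((summable_geometric_of_lt_one hr0 hr1).mul_right _)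

lemma digitSeries_nonneg (hr0 : 0 ≤ r) (a : ℕ → Fin N) : 0 ≤ digitSeries r a :=
  tsum_nonneg fun n => by positivity

lemma digitSeries_le (hr0 : 0 ≤ r) (hr1 : r < 1) (a : ℕ → Fin N) :
    digitSeries r a ≤ (N - 1) / (1 - r) := by
  have h := (summable_digitSeries hr0 hr1 a).tsum_mono
    ((summable_geometric_of_lt_one hr0 hr1).mul_right ((N : ℝ) - 1))
    (fun n => mul_le_mul_of_nonneg_left (digit_le (a n)) (by positivity))
  rw [tsum_mul_right, tsum_geometric_of_lt_one hr0 hr1] at h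
  rw [div_eq_inv_mul]
  exact h

lemma digitSeries_eq_sum_add (hr0 : 0 ≤ r) (hr1 : r < 1) (a : ℕ → Fin N) (n : ℕ) :
    digitSeries r a = (∑ i ∈ Finset.range n, r ^ i * ((a i : ℕ) : ℝ)) +
      r ^ n * digitSeries r (fun i => a (i + n)) := by
  rw [digitSeries, ← (summable_digitSeries hr0 hr1 a).sum_add_tsum_nat_add n, digitSeries,
    ← tsum_mul_left]
  congr 2
  ext i
  ring

lemma digitSeries_eq_add (hr0 : 0 ≤ r) (hr1 : r < 1) (a : ℕ → Fin N) :
    digitSeries r a = ((a 0 : ℕ) : ℝ) + r * digitSeries r (fun i => a (i + 1)) := by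
  simpa using digitSeries_eq_sum_add hr0 hr1 a 1

lemma pow_le_two_mul_abs_digitSeries_sub (hr0 : 0 < r) (hr : 2 * N * r ≤ 1)
    {a b : ℕ → Fin N} {n : ℕ} (hlt : ∀ i < n, a i = b i) (hne : a n ≠ b n) :
    r ^ n ≤ 2 * |digitSeries r a - digitSeries r b| := by
  have hN : (1 : ℝ) ≤ N := by exact_mod_cast Fin.pos (a n)
  have hr1 : r < 1 := by nlinarith
  have hsum : ∑ i ∈ Finset.range n, r ^ i * ((a i : ℕ) : ℝ) =
      ∑ i ∈ Finset.range n, r ^ i * ((b i : ℕ) : ℝ) :=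
    Finset.sum_congr rfl fun i hi => by rw [hlt i (Finset.mem_range.mp hi)]
  rw [digitSeries_eq_sum_add hr0.le hr1 a n, digitSeries_eq_sum_add hr0.le hr1 b n, hsum,
    add_sub_add_left_eq_sub, ← mul_sub, abs_mul, abs_of_pos (pow_pos hr0 n),
    digitSeries_eq_add hr0.le hr1 (fun i => a (i + n)),
    digitSeries_eq_add hr0.le hr1 (fun i => b (i + n))]
  set S := digitSeries r fun i => a (i + 1 + n)
  set T := digitSeries r fun i => b (i + 1 + n)
  have hS0 : 0 ≤ S := digitSeries_nonneg hr0.le _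
  have hT0 : 0 ≤ T := digitSeries_nonneg hr0.le _
  have key : r * ((N - 1) / (1 - r)) ≤ 1 / 2 := by
    rw [← mul_div_assoc, div_le_iff₀ (by linarith)]
    nlinarith
  have hS1 : r * S ≤ 1 / 2 :=
    (mul_le_mul_of_nonneg_left (digitSeries_le hr0.le hr1 _) hr0.le).trans key
  have hT1 : r * T ≤ 1 / 2 :=
    (mul_le_mul_of_nonneg_left (digitSeries_le hr0.le hr1 _) hr0.le).trans key
  have hS2 : 0 ≤ r * S := by positivity
  have hT2 : 0 ≤ r * T := by positivity
  have hmain : 1 / 2 ≤ |((a (0 + n) : ℕ) : ℝ) + r * S - (((b (0 + n) : ℕ) : ℝ) + r * T)| := by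
    rw [zero_add]
    have hne' : (a n : ℕ) ≠ (b n : ℕ) := fun h => hne (Fin.ext h)
    rcases lt_or_gt_of_ne hne' with h | h
    · have : ((a n : ℕ) : ℝ) + 1 ≤ (b n : ℕ) := by exact_mod_cast h
      rw [abs_sub_comm]
      exact le_trans (by linarith) (le_abs_self _)
    · have : ((b n : ℕ) : ℝ) + 1 ≤ (a n : ℕ) := by exact_mod_cast h
      exact le_trans (by linarith) (le_abs_self _)
  have := mul_le_mul_of_nonneg_left hmain (pow_pos hr0 n).le
  linarith

lemma digitSeries_injective (hr0 : 0 < r) (hr : 2 * N * r ≤ 1) :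
    Function.Injective (digitSeries (N := N) r) := by
  classical
  intro a b hab
  by_contra hne
  have hex : ∃ n, a n ≠ b n := Function.ne_iff.mp hne
  have h := pow_le_two_mul_abs_digitSeries_sub hr0 hr
    (fun i hi => not_not.mp (Nat.find_min hex hi)) (Nat.find_spec hex)
  rw [hab, sub_self, abs_zero, mul_zero] at h
  exact (pow_pos hr0 _).not_ge h

/-- The set of digit series in a small ratio `r` has dimension at least `log N / log (1 / r)`. -/
lemma le_dimH_range_digitSeries (hN : 1 < N) (hr0 : 0 < r) (hr : 2 * N * r ≤ 1) {s : NNReal}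
    (hs0 : 0 < s) (hs : 1 ≤ N * r ^ (s : ℝ)) :
    (s : ENNReal) ≤ dimH (range (digitSeries (N := N) r)) := by
  classical
  have : NeZero N := ⟨by omega⟩
  have hN0 : (0 : ℝ) < N := by exact_mod_cast (by omega : 0 < N)
  let φ : ℝ → ℝ := fun y => Real.ofDigits (Function.invFun (digitSeries (N := N) r) y)
  have hφ (a : ℕ → Fin N) : φ (digitSeries r a) = Real.ofDigits a := by
    simp only [φ]
    rw [Function.leftInverse_invFun (digitSeries_injective hr0 hr) a]
  have hdist (a b : ℕ → Fin N) : |Real.ofDigits a - Real.ofDigits b| ≤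
      (2 * |digitSeries r a - digitSeries r b|) ^ (s : ℝ) := by
    by_cases hab : a = b
    · subst hab
      simp only [sub_self, abs_zero]
      positivity
    have hex : ∃ n, a n ≠ b n := Function.ne_iff.mp hab
    have hlt : ∀ i < Nat.find hex, a i = b i := fun i hi => not_not.mp (Nat.find_min hex hi)
    refine (Real.abs_ofDigits_sub_ofDigits_le hlt).trans ?_
    refine le_trans ?_ (Real.rpow_le_rpow (by positivity)
      (pow_le_two_mul_abs_digitSeries_sub hr0 hr hlt (Nat.find_spec hex)) s.2)
    rw [← Real.rpow_natCast r, ← Real.rpow_mul hr0.le, mul_comm, Real.rpow_mul hr0.le,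
      Real.rpow_natCast, ← inv_pow]
    refine pow_le_pow_left₀ (by positivity) ?_ _
    rw [inv_le_iff_one_le_mul₀' hN0]
    exact hs
  have hholder : HolderOnWith (2 ^ (s : ℝ)) s φ (range (digitSeries (N := N) r)) := by
    rintro _ ⟨a, rfl⟩ _ ⟨b, rfl⟩
    rw [hφ, hφ, edist_dist, edist_dist, Real.dist_eq, Real.dist_eq,
      ENNReal.ofReal_rpow_of_nonneg (abs_nonneg _) s.coe_nonneg]
    have h2 : (((2 : NNReal) ^ (s : ℝ) : NNReal) : ENNReal) = ENNReal.ofReal (2 ^ (s : ℝ)) := by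
      rw [ENNReal.ofReal]
      congr 1
      ext
      simp [Real.coe_toNNReal _ (Real.rpow_nonneg zero_le_two (s : ℝ))]
    rw [h2, ← ENNReal.ofReal_mul (by positivity), ← Real.mul_rpow zero_le_two (abs_nonneg _)]
    exact ENNReal.ofReal_le_ofReal (hdist a b)
  have himage : Icc (0 : ℝ) 1 ⊆ φ '' range (digitSeries (N := N) r) := by
    intro y hy
    obtain ⟨a, -, rfl⟩ := Real.ofDigits_SurjOn hN hy
    exact ⟨_, mem_range_self a, hφ a⟩
  have hIcc : dimH (Icc (0 : ℝ) 1) = 1 := by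
    rw [Real.dimH_of_nonempty_interior (by simp)]
    simp
  have h1 : (1 : ENNReal) ≤ dimH (range (digitSeries (N := N) r)) / s :=
    hIcc ▸ (dimH_mono himage).trans (hholder.dimH_image_le hs0)
  have hs' : (s : ENNReal) ≠ 0 := by exact_mod_cast hs0.ne'
  rw [ENNReal.le_div_iff_mul_le (Or.inl hs') (Or.inl ENNReal.coe_ne_top), one_mul] at h1
  exact h1

end DigitSeries

section Lacunary

variable {h : ℝ → ℝ} {k : ℕ}

lemma exists_bound_iteratedDeriv (hh : ContDiff ℝ k h) (hper : Function.Periodic h 1) :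
    ∃ C : ℕ → ℝ, ∀ j ≤ k, ∀ x, |iteratedDeriv j h x| ≤ C j := by
  have (j : ℕ) : ∃ C : ℝ, j ≤ k → ∀ x, |iteratedDeriv j h x| ≤ C := by
    by_cases hj : j ≤ k
    · have hp : Function.Periodic (iteratedDeriv j h) 1 := fun x => by
        rw [← congrFun (iteratedDeriv_comp_add_const (n := j) (f := h) (s := 1)) x,
          funext hper]
      have hc : Continuous (iteratedDeriv j h) :=
        hh.continuous_iteratedDeriv j (by exact_mod_cast hj)
      obtain ⟨C, hC⟩ := (hp.isBounded_of_continuous one_ne_zero hc).exists_norm_le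
      exact ⟨C, fun _ x => hC _ (mem_range_self x)⟩
    · exact ⟨0, fun h => absurd h hj⟩
  choose C hC using this
  exact ⟨C, fun j hj x => hC j hj x⟩

variable {b μ : ℝ}

lemma contDiff_lacunary (hh : ContDiff ℝ k h) (hper : Function.Periodic h 1) (hb : 1 ≤ b)
    (hμ : 0 ≤ μ) (hμb : μ * b ^ k < 1) :
    ContDiff ℝ k fun x => ∑' n : ℕ, μ ^ n * h (b ^ n * x) := by
  obtain ⟨C, hC⟩ := exists_bound_iteratedDeriv hh hper
  refine contDiff_tsum (N := (k : ℕ∞)) (v := fun j n => (μ * b ^ j) ^ n * C j) ?_ ?_ ?_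
  · intro n
    exact contDiff_const.mul (hh.comp (contDiff_const.mul contDiff_id))
  · intro j hj
    have hj : j ≤ k := by exact_mod_cast hj
    exact (summable_geometric_of_lt_one (by positivity)
      ((mul_le_mul_of_nonneg_left (pow_le_pow_right₀ hb hj) hμ).trans_lt hμb)).mul_right _
  · intro j n x hj
    have hj : j ≤ k := by exact_mod_cast hj
    have hhj : ContDiff ℝ j h := hh.of_le (by exact_mod_cast hj)
    rw [norm_iteratedFDeriv_eq_norm_iteratedDeriv, iteratedDeriv_const_mul_field,
      iteratedDeriv_comp_const_mul hhj, Real.norm_eq_abs, abs_mul, abs_mul,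
      abs_of_nonneg (by positivity), abs_of_nonneg (by positivity), mul_pow, mul_assoc,
      pow_right_comm b j n]
    gcongr
    exact hC j hj _

lemma deriv_lacunary_eq_zero (hk : 1 ≤ k) (hh : ContDiff ℝ k h) (hper : Function.Periodic h 1)
    (hb : 1 ≤ b) (hμ : 0 ≤ μ) (hμb : μ * b ^ k < 1) {x : ℝ}
    (hx : ∀ n : ℕ, deriv h (b ^ n * x) = 0) :
    deriv (fun x => ∑' n : ℕ, μ ^ n * h (b ^ n * x)) x = 0 := by
  obtain ⟨C, hC⟩ := exists_bound_iteratedDeriv hh hper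
  have hdiff : Differentiable ℝ h := hh.differentiable (by exact_mod_cast (by omega : k ≠ 0))
  have hsum (j : ℕ) (hj : j ≤ k) : Summable fun n : ℕ => (μ * b ^ j) ^ n * C j :=
    (summable_geometric_of_lt_one (by positivity)
      ((mul_le_mul_of_nonneg_left (pow_le_pow_right₀ hb hj) hμ).trans_lt hμb)).mul_right _
  have hderiv (n : ℕ) (y : ℝ) : HasDerivAt (fun y => μ ^ n * h (b ^ n * y))
      (μ ^ n * (deriv h (b ^ n * y) * b ^ n)) y := by
    have h1 : HasDerivAt (fun y : ℝ => b ^ n * y) (b ^ n) y := by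
      simpa using (hasDerivAt_id y).const_mul (b ^ n)
    exact ((hdiff _).hasDerivAt.comp y h1).const_mul _
  have key := hasDerivAt_tsum (hsum 1 hk) hderiv (y₀ := x) (fun n y => by
      have := hC 1 hk (b ^ n * y)
      rw [iteratedDeriv_one] at this
      rw [Real.norm_eq_abs, abs_mul, abs_mul, abs_of_nonneg (pow_nonneg hμ n),
        abs_of_nonneg (by positivity : 0 ≤ b ^ n), mul_pow, pow_one, mul_comm |_|, ← mul_assoc]
      gcongr)
    (Summable.of_norm_bounded (hsum 0 (Nat.zero_le k)) fun n => by
      have := hC 0 (Nat.zero_le k) (b ^ n * x)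
      rw [iteratedDeriv_zero] at this
      rw [Real.norm_eq_abs, abs_mul, abs_of_nonneg (pow_nonneg hμ n), pow_zero, mul_one]
      gcongr) x
  rw [key.deriv]
  simp [hx]

end Lacunary

/-- A smooth `1`-periodic function which equals `d` on the interval of numbers whose expansion in
base `4 * N` starts with the digit `2 * d`, for every `d < N`. -/
lemma exists_periodic_eq_digit (N k : ℕ) :
    ∃ h : ℝ → ℝ, ContDiff ℝ k h ∧ Function.Periodic h 1 ∧
      ∀ d < N, ∀ y ∈ Icc (2 * d / (4 * N) : ℝ) ((2 * d + 1) / (4 * N)), h y = d := by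
  let c : ℝ → ℝ := fun t => Real.cos (2 * Real.pi * t)
  have hcper : Function.Periodic c 1 := fun t => by
    simp only [c, mul_add, mul_one, Real.cos_add_two_pi]
  have hcanti : StrictAntiOn c (Icc 0 (1 / 2)) := fun s hs t ht hst =>
    Real.strictAntiOn_cos
      ⟨by have := hs.1; positivity, by nlinarith [hs.2, Real.pi_pos]⟩
      ⟨by have := ht.1; positivity, by nlinarith [ht.2, Real.pi_pos]⟩
      (mul_lt_mul_of_pos_left hst Real.two_pi_pos)
  let u : ℕ → ℝ := fun j => (2 * j + 1) / (4 * N)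
  let v : ℕ → ℝ := fun j => (2 * j + 2) / (4 * N)
  refine ⟨fun y => ∑ j ∈ Finset.range N,
    Real.smoothTransition ((c (u j) - c y) / (c (u j) - c (v j))), ?_, ?_, ?_⟩
  · refine ContDiff.sum fun j _ => ?_
    have hc : ContDiff ℝ k c := Real.contDiff_cos.comp (contDiff_const.mul contDiff_id)
    exact (Real.smoothTransition.contDiff (n := k)).comp
      ((contDiff_const.sub hc).div_const _)
  · intro y
    simp only [hcper y]
  · intro d hd y hy
    have hN : (0 : ℝ) < N := by exact_mod_cast (by omega : 0 < N)
    have hdN : (d : ℝ) + 1 ≤ N := by exact_mod_cast hd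
    have hy0 : 0 ≤ y := le_trans (by positivity) hy.1
    have hy1 : y ≤ 1 / 2 := hy.2.trans (by rw [div_le_iff₀ (by positivity)]; linarith)
    have hterm : ∀ j ∈ Finset.range N,
        Real.smoothTransition ((c (u j) - c y) / (c (u j) - c (v j))) =
          if j < d then 1 else 0 := by
      intro j hj
      have hjN : (j : ℝ) + 1 ≤ N := by exact_mod_cast Finset.mem_range.mp hj
      have hu0 : 0 ≤ u j := by positivity
      have huv : u j < v j := by
        simp only [u, v]
        gcongr
        norm_num
      have hv1 : v j ≤ 1 / 2 := by
        simp only [v]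
        rw [div_le_iff₀ (by positivity)]
        linarith
      have hpos : 0 < c (u j) - c (v j) :=
        sub_pos.mpr (hcanti ⟨hu0, huv.le.trans hv1⟩ ⟨hu0.trans huv.le, hv1⟩ huv)
      split_ifs with hjd
      · apply Real.smoothTransition.one_of_one_le
        rw [one_le_div hpos]
        have hvy : v j ≤ y := by
          refine le_trans ?_ hy.1
          have : (j : ℝ) + 1 ≤ d := by exact_mod_cast hjd
          simp only [v]
          gcongr
          linarith
        have := hcanti.antitoneOn ⟨hu0.trans huv.le, hv1⟩ ⟨hy0, hy1⟩ hvy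
        linarith
      · apply Real.smoothTransition.zero_of_nonpos
        have hyu : y ≤ u j := by
          refine hy.2.trans ?_
          have : (d : ℝ) ≤ j := by exact_mod_cast not_lt.mp hjd
          simp only [u]
          gcongr
        have := hcanti.antitoneOn ⟨hy0, hy1⟩ ⟨hu0, huv.le.trans hv1⟩ hyu
        exact div_nonpos_of_nonpos_of_nonneg (by linarith) hpos.le
    have hfilter : (Finset.range N).filter (· < d) = Finset.range d := by
      ext j
      simp only [Finset.mem_filter, Finset.mem_range]
      omega
    beta_reduce
    rw [Finset.sum_congr rfl hterm, Finset.sum_boole, hfilter, Finset.card_range]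

lemma deriv_eq_zero_of_eqOn_Icc {h : ℝ → ℝ} (hh : Differentiable ℝ h) {a b c y : ℝ} (hab : a < b)
    (hc : ∀ z ∈ Icc a b, h z = c) (hy : y ∈ Icc a b) : deriv h y = 0 := by
  rw [← (hh y).derivWithin (uniqueDiffOn_Icc hab y hy),
    derivWithin_congr (f := fun _ => c) hc (hc y hy)]
  simp

section DigitPoint

variable {N : ℕ}

/-- The number whose expansion in base `4 * N` has the digits `2 * a n`. -/
noncomputable def digitPoint (a : ℕ → Fin N) : ℝ :=
  2 * (4 * N : ℝ)⁻¹ * digitSeries (4 * N : ℝ)⁻¹ a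

lemma mul_digitPoint (a : ℕ → Fin N) :
    4 * N * digitPoint a = 2 * (a 0 : ℕ) + digitPoint fun i => a (i + 1) := by
  have hN : (1 : ℝ) ≤ N := by exact_mod_cast Fin.pos (a 0)
  rw [digitPoint, digitPoint, digitSeries_eq_add (by positivity)
    (inv_lt_one_of_one_lt₀ (by linarith)) a]
  field_simp

lemma digitPoint_mem_Icc_zero_one (a : ℕ → Fin N) : digitPoint a ∈ Icc (0 : ℝ) 1 := by
  have hN : (1 : ℝ) ≤ N := by exact_mod_cast Fin.pos (a 0)
  have hr1 : (4 * N : ℝ)⁻¹ < 1 := inv_lt_one_of_one_lt₀ (by linarith)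
  have h0 : (0 : ℝ) ≤ digitSeries (4 * N : ℝ)⁻¹ a := digitSeries_nonneg (by positivity) a
  refine ⟨by rw [digitPoint]; positivity, ?_⟩
  have h1 : digitSeries (4 * N : ℝ)⁻¹ a ≤ (N - 1) / (1 - (4 * N : ℝ)⁻¹) :=
    digitSeries_le (by positivity) hr1 a
  have h2 : ((N : ℝ) - 1) / (1 - (4 * N : ℝ)⁻¹) ≤ N := by
    rw [div_le_iff₀ (by linarith), mul_sub, mul_one, mul_inv_rev,
      mul_inv_cancel_left₀ (by positivity)]
    linarith
  calc digitPoint a ≤ 2 * (4 * N : ℝ)⁻¹ * N := by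
        rw [digitPoint]; gcongr; exact h1.trans h2
    _ ≤ 1 := by field_simp; norm_num

lemma digitPoint_mem_Icc (a : ℕ → Fin N) :
    digitPoint a ∈ Icc (2 * (a 0 : ℕ) / (4 * N) : ℝ) ((2 * (a 0 : ℕ) + 1) / (4 * N)) := by
  have hN : (1 : ℝ) ≤ N := by exact_mod_cast Fin.pos (a 0)
  have h := mul_digitPoint a
  have h' := digitPoint_mem_Icc_zero_one fun i => a (i + 1)
  constructor
  · rw [div_le_iff₀ (by positivity)]
    linarith [h'.1]
  · rw [le_div_iff₀ (by positivity)]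
    linarith [h'.2]

lemma exists_pow_mul_digitPoint (a : ℕ → Fin N) (n : ℕ) :
    ∃ m : ℕ, (4 * N : ℝ) ^ n * digitPoint a = digitPoint (fun i => a (i + n)) + m := by
  induction n with
  | zero => exact ⟨0, by simp⟩
  | succ n ih =>
    obtain ⟨m, hm⟩ := ih
    refine ⟨2 * (a n : ℕ) + 4 * N * m, ?_⟩
    have h := mul_digitPoint fun i => a (i + n)
    simp only [zero_add, add_right_comm _ 1 n] at h
    rw [pow_succ', mul_assoc, hm, mul_add, h]
    push_cast
    simp only [← add_assoc]
    ring

end DigitPoint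

lemma exists_pow_rpow_le {t : ℝ} (ht : t < 1) : ∃ N : ℕ, 1 < N ∧ (8 * N : ℝ) ^ t ≤ N := by
  have htend : Filter.Tendsto (fun N : ℕ => (N : ℝ) ^ (1 - t)) Filter.atTop Filter.atTop :=
    (tendsto_rpow_atTop (sub_pos.mpr ht)).comp tendsto_natCast_atTop_atTop
  obtain ⟨N, hN, hN1⟩ :=
    ((htend.eventually_ge_atTop (8 ^ t)).and (Filter.eventually_gt_atTop 1)).exists
  have hN0 : (0 : ℝ) < N := by exact_mod_cast (by omega : 0 < N)
  refine ⟨N, hN1, ?_⟩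
  rw [Real.mul_rpow (by norm_num) hN0.le]
  calc (8 : ℝ) ^ t * (N : ℝ) ^ t ≤ (N : ℝ) ^ (1 - t) * (N : ℝ) ^ t := by gcongr
    _ = N := by rw [← Real.rpow_add hN0]; simp

/-- For `k ≥ 1` and every `η > 0` there is a `C^k` function `f` on `(-2, 2)` whose
critical set `A = {x ∈ (-2,2) : f'(x) = 0}` has image of Hausdorff dimension
greater than `1/k - η`. -/
theorem exists_contDiffOn_dimH_image_critical_gt (k : ℕ) (hk : 1 ≤ k) (η : ℝ)
    (hη : 0 < η) :
    ∃ f : ℝ → ℝ, ContDiffOn ℝ k f (Set.Ioo (-2 : ℝ) 2) ∧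
      ENNReal.ofReal (1 / k - η) <
        dimH (f '' {x : ℝ | x ∈ Set.Ioo (-2 : ℝ) 2 ∧ deriv f x = 0}) := by
  have hk0 : (0 : ℝ) < k := by exact_mod_cast hk
  obtain ⟨s, hs, hsk⟩ : ∃ s : ℝ, max 0 (1 / k - η) < s ∧ s < 1 / k :=
    exists_between (max_lt (by positivity) (by linarith))
  have hs0 : 0 < s := (le_max_left _ _).trans_lt hs
  lift s to NNReal using hs0.le
  have hks : (k : ℝ) * s < 1 := by rwa [lt_div_iff₀' hk0] at hsk
  obtain ⟨N, hN, hNs⟩ := exists_pow_rpow_le hks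
  have hN1 : (1 : ℝ) < N := by exact_mod_cast hN
  obtain ⟨h, hh, hper, hdigit⟩ := exists_periodic_eq_digit N k
  have hdiff : Differentiable ℝ h := hh.differentiable (by exact_mod_cast (by omega : k ≠ 0))
  set μ : ℝ := ((8 * N : ℝ) ^ k)⁻¹ with hμ
  have hμ0 : 0 < μ := by positivity
  have hμb : μ * (4 * N) ^ k < 1 := by
    rw [inv_mul_lt_one₀ (by positivity)]
    exact pow_lt_pow_left₀ (by linarith) (by positivity) (by omega)
  have hμN : 2 * N * μ ≤ 1 := by
    rw [← div_eq_mul_inv, div_le_one (by positivity)]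
    calc (2 * N : ℝ) ≤ 8 * N := by linarith
      _ ≤ (8 * N) ^ k := le_self_pow₀ (by linarith) (by omega)
  have hμs : 1 ≤ N * μ ^ (s : ℝ) := by
    rw [hμ, Real.inv_rpow (by positivity), ← Real.rpow_natCast, ← Real.rpow_mul (by positivity),
      ← div_eq_mul_inv, one_le_div (by positivity)]
    exact hNs
  let f : ℝ → ℝ := fun x => ∑' n : ℕ, μ ^ n * h ((4 * N) ^ n * x)
  have hperm (n : ℕ) (a : ℕ → Fin N) (g : ℝ → ℝ) (hg : Function.Periodic g 1) :
      g ((4 * N) ^ n * digitPoint a) = g (digitPoint fun i => a (i + n)) := by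
    obtain ⟨m, hm⟩ := exists_pow_mul_digitPoint a n
    rw [hm]
    simpa using hg.nat_mul m (digitPoint fun i => a (i + n))
  have hderivper : Function.Periodic (deriv h) 1 := fun x => by
    rw [← deriv_comp_add_const, funext hper]
  refine ⟨f, (contDiff_lacunary hh hper (by linarith) hμ0.le hμb).contDiffOn, ?_⟩
  have hsub : range (digitSeries (N := N) μ) ⊆
      f '' {x : ℝ | x ∈ Set.Ioo (-2 : ℝ) 2 ∧ deriv f x = 0} := by
    rintro _ ⟨a, rfl⟩
    have hmem := digitPoint_mem_Icc_zero_one a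
    refine ⟨digitPoint a, ⟨⟨by linarith [hmem.1], by linarith [hmem.2]⟩, ?_⟩, ?_⟩
    · refine deriv_lacunary_eq_zero hk hh hper (by linarith) hμ0.le hμb fun n => ?_
      rw [hperm n a _ hderivper]
      refine deriv_eq_zero_of_eqOn_Icc hdiff ?_ (hdigit _ (a (0 + n)).2)
        (digitPoint_mem_Icc fun i => a (i + n))
      gcongr
      linarith
    · refine tsum_congr fun n => ?_
      rw [hperm n a h hper, hdigit _ (a (0 + n)).2 _ (digitPoint_mem_Icc fun i => a (i + n)),
        zero_add]
  calc ENNReal.ofReal (1 / k - η) < s := by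
        rw [← ENNReal.ofReal_coe_nnreal]
        exact (ENNReal.ofReal_lt_ofReal_iff hs0).mpr ((le_max_right _ _).trans_lt hs)
    _ ≤ dimH (range (digitSeries (N := N) μ)) :=
        le_dimH_range_digitSeries hN hμ0 hμN (by exact_mod_cast hs0) hμs
    _ ≤ _ := dimH_mono hsub
end

section
/- Let k ≥ 1 be a natural number. There exists a k-times continuously differentiable function f : (-2,2) → ℝ such that the set {y ∈ ℝ : dim_H f⁻¹(y) = 1} is uncountable; i.e. f has an uncountable family of level sets of Hausdorff dimension 1. -/
open MeasureTheory Set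

open scoped NNReal ENNReal

/-- A smooth `1`-periodic function equal to `0` on `[0, 1/4]` and to `1` on `[1/2, 3/4]`. -/
noncomputable def periodicStep (t : ℝ) : ℝ :=
  Real.smoothTransition (-2 * Real.cos (2 * Real.pi * t - Real.pi / 4))

lemma contDiff_periodicStep (n : ℕ) : ContDiff ℝ n periodicStep := by
  have h : ContDiff ℝ n Real.smoothTransition :=
    Real.smoothTransition.contDiff (n := (n : ℕ∞))
  exact h.comp (by fun_prop)

lemma periodicStep_add_natCast (t : ℝ) (n : ℕ) : periodicStep (t + n) = periodicStep t := by
  unfold periodicStep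
  rw [show 2 * Real.pi * (t + n) - Real.pi / 4 =
    2 * Real.pi * t - Real.pi / 4 + n * (2 * Real.pi) by ring, Real.cos_add_nat_mul_two_pi]

lemma periodicStep_eq_zero {t : ℝ} (h₀ : 0 ≤ t) (h₁ : t ≤ 1 / 4) : periodicStep t = 0 := by
  have hpi := Real.pi_pos
  refine Real.smoothTransition.zero_of_nonpos ?_
  have : 0 ≤ Real.cos (2 * Real.pi * t - Real.pi / 4) :=
    Real.cos_nonneg_of_neg_pi_div_two_le_of_le (by nlinarith) (by nlinarith)
  linarith

lemma periodicStep_eq_one {t : ℝ} (h₀ : 1 / 2 ≤ t) (h₁ : t ≤ 3 / 4) : periodicStep t = 1 := by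
  have hpi := Real.pi_pos
  refine Real.smoothTransition.one_of_one_le ?_
  have h : 1 / 2 ≤ Real.cos (2 * Real.pi * (t - 1 / 2) - Real.pi / 4) := by
    rw [← Real.cos_abs (2 * Real.pi * (t - 1 / 2) - Real.pi / 4)]
    refine Real.cos_pi_div_three.symm.trans_le ?_
    refine Real.cos_le_cos_of_nonneg_of_le_pi (abs_nonneg _) (by linarith) ?_
    rw [abs_le]
    constructor <;> nlinarith
  rw [show 2 * Real.pi * t - Real.pi / 4 =
    2 * Real.pi * (t - 1 / 2) - Real.pi / 4 + Real.pi by ring, Real.cos_add_pi]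
  linarith

lemma exists_bound_iteratedDeriv_periodicStep (n : ℕ) :
    ∃ C : ℝ, ∀ t, ‖iteratedDeriv n periodicStep t‖ ≤ C := by
  have hp : Function.Periodic (iteratedDeriv n periodicStep) 1 := by
    intro t
    have h := congrFun (iteratedDeriv_comp_add_const n periodicStep 1) t
    rw [← h]
    congr 1
    funext z
    simpa using periodicStep_add_natCast z 1
  obtain ⟨C, hC⟩ := (hp.isBounded_of_continuous one_ne_zero
    ((contDiff_periodicStep n).continuous_iteratedDeriv n le_rfl)).exists_norm_le
  exact ⟨C, fun t => hC _ (mem_range_self t)⟩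

/-- A lacunary series of `C^k` class whose `j`-th term detects a digit of `x` in a mixed base. -/
noncomputable def lacunarySeries (k : ℕ) (x : ℝ) : ℝ :=
  ∑' j : ℕ, (1 / 4 : ℝ) ^ ((k + 1) * (j ^ 2 + j)) * periodicStep (4 ^ (j ^ 2 + j) * x)

lemma contDiff_lacunarySeries (k : ℕ) : ContDiff ℝ k (lacunarySeries k) := by
  choose C hC using exists_bound_iteratedDeriv_periodicStep
  have hC₀ : ∀ n, 0 ≤ C n := fun n => (norm_nonneg _).trans (hC n 0)
  refine contDiff_tsum (N := (k : ℕ∞)) (v := fun n j => (1 / 4 : ℝ) ^ j * C n) ?_ ?_ ?_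
  · intro j
    exact contDiff_const.mul ((contDiff_periodicStep k).comp (by fun_prop))
  · intro n _
    exact (summable_geometric_of_lt_one (by norm_num) (by norm_num)).mul_right _
  · intro n j x hn
    have hn : n ≤ k := by exact_mod_cast hn
    rw [norm_iteratedFDeriv_eq_norm_iteratedDeriv, iteratedDeriv_const_mul_field,
      iteratedDeriv_comp_const_mul (contDiff_periodicStep n), norm_mul, norm_mul, ← mul_assoc]
    refine mul_le_mul ?_ (hC _ _) (norm_nonneg _) (by positivity)
    rw [norm_pow, norm_pow, norm_pow, ← pow_mul]
    have h4 : ‖(4 : ℝ)‖ = 4 := by norm_num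
    have h14 : ‖(1 / 4 : ℝ)‖ = 1 / 4 := by norm_num
    rw [h4, h14]
    calc (1 / 4 : ℝ) ^ ((k + 1) * (j ^ 2 + j)) * 4 ^ ((j ^ 2 + j) * n)
        ≤ (1 / 4 : ℝ) ^ ((n + 1) * (j ^ 2 + j)) * 4 ^ ((j ^ 2 + j) * n) := by
          gcongr ?_ * _
          exact pow_le_pow_of_le_one (by norm_num) (by norm_num) (by gcongr)
      _ = (1 / 4 : ℝ) ^ (j ^ 2 + j) := by
          rw [show (n + 1) * (j ^ 2 + j) = (j ^ 2 + j) + (j ^ 2 + j) * n by ring, pow_add,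
            mul_assoc, ← mul_pow]
          norm_num
      _ ≤ (1 / 4 : ℝ) ^ j := pow_le_pow_of_le_one (by norm_num) (by norm_num) (by nlinarith)

/-- The value of the lacunary series at points with prescribed leading digits `b`. -/
noncomputable def lacunaryValue (k : ℕ) (b : ℕ → Bool) : ℝ :=
  ∑' j : ℕ, cond (b j) ((1 / 4 : ℝ) ^ ((k + 1) * (j ^ 2 + j))) 0

lemma lacunaryValue_injective (k : ℕ) : Function.Injective (lacunaryValue k) := by
  set q : ℕ → ℕ := fun j => (k + 1) * (j ^ 2 + j) with hq
  have hqi : Function.Injective q := by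
    refine StrictMono.injective (strictMono_nat_of_lt_succ fun j => ?_)
    simp only [hq]
    gcongr <;> omega
  have key : ∀ b, lacunaryValue k b =
      Cardinal.cantorFunction (1 / 4) (Function.extend q b fun _ => false) := by
    intro b
    rw [Cardinal.cantorFunction, ← hqi.tsum_eq]
    · simp only [lacunaryValue, Cardinal.cantorFunctionAux, hqi.extend_apply]
      rfl
    · intro i hi
      by_contra hni
      refine hi ?_
      rw [Cardinal.cantorFunctionAux, Function.extend_apply' _ _ _ hni]
      rfl
  intro b b' h
  rw [key, key] at h
  have h' := Cardinal.cantorFunction_injective (by norm_num) (by norm_num) h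
  funext j
  simpa [hqi.extend_apply] using congrFun h' (q j)

/-- Numerators of the partial sums of the expansion with digits `e j` in bases `4 ^ (2 j + 2)`. -/
def expansionNumer (e : ℕ → ℕ) : ℕ → ℕ
  | 0 => 0
  | j + 1 => 4 ^ (2 * j + 2) * expansionNumer e j + e j

/-- The real number with digits `e j` in bases `4 ^ (2 j + 2)`. -/
noncomputable def expansionPoint (e : ℕ → ℕ) : ℝ :=
  ⨆ j, (expansionNumer e j : ℝ) / 4 ^ (j ^ 2 + j)

lemma expansionNumer_succ_div (e : ℕ → ℕ) (j : ℕ) :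
    (expansionNumer e (j + 1) : ℝ) / 4 ^ ((j + 1) ^ 2 + (j + 1)) =
      expansionNumer e j / 4 ^ (j ^ 2 + j) + e j / 4 ^ ((j + 1) ^ 2 + (j + 1)) := by
  rw [expansionNumer, show (j + 1) ^ 2 + (j + 1) = (2 * j + 2) + (j ^ 2 + j) by ring, pow_add _ (2 * j + 2),
    ← div_div _ _ ((4 : ℝ) ^ (j ^ 2 + j)), ← div_div _ _ ((4 : ℝ) ^ (j ^ 2 + j)), ← add_div,
    Nat.cast_add, Nat.cast_mul, Nat.cast_pow, add_div, Nat.cast_ofNat,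
    mul_div_cancel_left₀ _ (by positivity)]

lemma expansionPoint_mem {e : ℕ → ℕ} (he : ∀ j, e j + 1 ≤ 3 * 4 ^ (2 * j + 1)) (j : ℕ) :
    expansionPoint e ∈ Icc ((expansionNumer e j : ℝ) / 4 ^ (j ^ 2 + j))
      ((expansionNumer e j + 3 / 4 : ℝ) / 4 ^ (j ^ 2 + j)) := by
  have h := Monotone.ciSup_mem_iInter_Icc_of_antitone
    (f := fun j => (expansionNumer e j : ℝ) / 4 ^ (j ^ 2 + j))
    (g := fun j => (expansionNumer e j + 3 / 4 : ℝ) / 4 ^ (j ^ 2 + j)) ?_ ?_ ?_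
  · exact mem_iInter.1 h j
  · refine monotone_nat_of_le_succ fun i => ?_
    rw [expansionNumer_succ_div]
    have : (0 : ℝ) ≤ e i / 4 ^ ((i + 1) ^ 2 + (i + 1)) := by positivity
    linarith
  · refine antitone_nat_of_succ_le fun i => ?_
    rw [add_div, expansionNumer_succ_div, add_assoc, ← add_div,
      add_div (expansionNumer e i : ℝ)]
    refine add_le_add le_rfl ?_
    have hi : (e i + 1 : ℝ) ≤ 3 * 4 ^ (2 * i + 1) := by exact_mod_cast he i
    rw [show (i + 1) ^ 2 + (i + 1) = (2 * i + 1) + 1 + (i ^ 2 + i) by ring,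
      pow_add _ _ (i ^ 2 + i), ← div_div]
    refine div_le_div_of_nonneg_right ?_ (by positivity)
    rw [div_le_iff₀ (by positivity), pow_succ]
    linarith
  · intro i
    simp only
    gcongr
    linarith

lemma periodicStep_expansionPoint {e : ℕ → ℕ} (he : ∀ j, e j + 1 ≤ 3 * 4 ^ (2 * j + 1)) (j : ℕ)
    {u : ℝ} (h₀ : u * 4 ^ (2 * j + 2) ≤ e j) (h₁ : e j + 3 / 4 ≤ (u + 1 / 4) * 4 ^ (2 * j + 2)) :
    ∃ t ∈ Icc u (u + 1 / 4),
      periodicStep (4 ^ (j ^ 2 + j) * expansionPoint e) = periodicStep t := by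
  have h := expansionPoint_mem he (j + 1)
  refine ⟨4 ^ (j ^ 2 + j) * expansionPoint e - expansionNumer e j, ?_, ?_⟩
  · rw [add_div, expansionNumer_succ_div, add_assoc, ← add_div,
      show (j + 1) ^ 2 + (j + 1) = (2 * j + 2) + (j ^ 2 + j) by ring,
      pow_add _ (2 * j + 2), ← div_div _ _ ((4 : ℝ) ^ (j ^ 2 + j)),
      ← div_div _ _ ((4 : ℝ) ^ (j ^ 2 + j)), ← add_div, ← add_div, mem_Icc, div_le_iff₀ (by positivity),
      le_div_iff₀ (by positivity), ← le_sub_iff_add_le', ← sub_le_iff_le_add'] at h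
    rw [mul_comm]
    refine ⟨le_trans ?_ h.1, h.2.trans ?_⟩
    · rwa [le_div_iff₀ (by positivity)]
    · rwa [div_le_iff₀ (by positivity)]
  · rw [← periodicStep_add_natCast (_ - _) (expansionNumer e j), sub_add_cancel]

/-- Digits of `t` in bases `4 ^ (2 j + 1)`. -/
noncomputable def baseDigit (t : ℝ) (j : ℕ) : ℕ :=
  ⌊4 ^ ((j + 1) ^ 2) * t⌋₊ % 4 ^ (2 * j + 1)

lemma floor_succ_div (t : ℝ) (j : ℕ) :
    ⌊4 ^ ((j + 1) ^ 2) * t⌋₊ / 4 ^ (2 * j + 1) = ⌊4 ^ (j ^ 2) * t⌋₊ := by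
  rw [← Nat.floor_div_natCast, show (j + 1) ^ 2 = (2 * j + 1) + j ^ 2 by ring, pow_add]
  congr 1
  push_cast
  field_simp

/-- The digits of `t`, shifted according to the prescribed leading digits `b`. -/
noncomputable def codedDigit (b : ℕ → Bool) (t : ℝ) (j : ℕ) : ℕ :=
  cond (b j) (2 * 4 ^ (2 * j + 1)) 0 + baseDigit t j

lemma baseDigit_lt (t : ℝ) (j : ℕ) : baseDigit t j < 4 ^ (2 * j + 1) :=
  Nat.mod_lt _ (by positivity)

lemma codedDigit_succ_le (b : ℕ → Bool) (t : ℝ) (j : ℕ) :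
    codedDigit b t j + 1 ≤ 3 * 4 ^ (2 * j + 1) := by
  have h := baseDigit_lt t j
  unfold codedDigit
  cases b j <;> simp only [cond_true, cond_false] <;> omega

lemma lacunarySeries_expansionPoint (k : ℕ) (b : ℕ → Bool) (t : ℝ) :
    lacunarySeries k (expansionPoint (codedDigit b t)) = lacunaryValue k b := by
  refine tsum_congr fun j => ?_
  have he := codedDigit_succ_le b t
  have hd : (baseDigit t j + 1 : ℝ) ≤ 4 ^ (2 * j + 1) := by exact_mod_cast baseDigit_lt t j
  have hp : (4 : ℝ) ^ (2 * j + 2) = 4 ^ (2 * j + 1) * 4 := pow_succ _ _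
  have hd₀ : (0 : ℝ) ≤ baseDigit t j := by positivity
  cases hb : b j
  · obtain ⟨v, hv, h⟩ := periodicStep_expansionPoint he j (u := 0)
      (by simp) (by simp only [codedDigit, hb, cond_false, hp]; push_cast; linarith)
    rw [h, periodicStep_eq_zero hv.1 (by linarith [hv.2])]
    simp
  · obtain ⟨v, hv, h⟩ := periodicStep_expansionPoint he j (u := 1 / 2)
      (by simp only [codedDigit, hb, cond_true, hp]; push_cast; linarith)
      (by simp only [codedDigit, hb, cond_true, hp]; push_cast; linarith)
    rw [h, periodicStep_eq_one hv.1 (by linarith [hv.2])]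
    simp

lemma expansionNumer_codedDigit_eq (b : ℕ → Bool) {s t : ℝ} {j : ℕ}
    (h : ⌊4 ^ (j ^ 2) * s⌋₊ = ⌊4 ^ (j ^ 2) * t⌋₊) :
    expansionNumer (codedDigit b s) j = expansionNumer (codedDigit b t) j := by
  induction j with
  | zero => rfl
  | succ j ih =>
    have hj : ⌊4 ^ (j ^ 2) * s⌋₊ = ⌊4 ^ (j ^ 2) * t⌋₊ := by
      rw [← floor_succ_div s, ← floor_succ_div t, h]
    rw [expansionNumer, expansionNumer, ih hj, codedDigit, codedDigit, baseDigit, baseDigit, h]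

lemma exists_first_floor_lt {s t : ℝ} (hs : s ∈ Ico (0 : ℝ) 1) (ht : t ∈ Ico (0 : ℝ) 1)
    (hst : s < t) : ∃ j : ℕ, ⌊4 ^ (j ^ 2) * s⌋₊ = ⌊4 ^ (j ^ 2) * t⌋₊ ∧
      ⌊4 ^ ((j + 1) ^ 2) * s⌋₊ < ⌊4 ^ ((j + 1) ^ 2) * t⌋₊ := by
  have hex : ∃ j : ℕ, ⌊4 ^ (j ^ 2) * s⌋₊ ≠ ⌊4 ^ (j ^ 2) * t⌋₊ := by
    obtain ⟨j, hj⟩ := pow_unbounded_of_one_lt (1 / (t - s)) (by norm_num : (1 : ℝ) < 4)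
    refine ⟨j, fun h => ?_⟩
    have h₁ := Nat.lt_floor_add_one (4 ^ (j ^ 2) * t)
    have h₂ := Nat.floor_le (a := 4 ^ (j ^ 2) * s) (mul_nonneg (by positivity) hs.1)
    rw [h] at h₂
    have hlt : 4 ^ (j ^ 2) * (t - s) < 1 := by linarith
    have h₃ : 1 < 4 ^ j * (t - s) := by rwa [div_lt_iff₀ (by linarith)] at hj
    have h₄ : (4 : ℝ) ^ j ≤ 4 ^ (j ^ 2) := pow_le_pow_right₀ (by norm_num) (by nlinarith)
    have h₅ := mul_le_mul_of_nonneg_right h₄ (sub_nonneg.2 hst.le)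
    linarith
  classical
  obtain ⟨j, hj⟩ : ∃ j, Nat.find hex = j + 1 := by
    refine Nat.exists_eq_succ_of_ne_zero fun h => ?_
    have h' := Nat.find_spec hex
    rw [h] at h'
    simp [Nat.floor_eq_zero.2 hs.2, Nat.floor_eq_zero.2 ht.2] at h'
  refine ⟨j, ?_, lt_of_le_of_ne (Nat.floor_mono (by gcongr)) (hj ▸ Nat.find_spec hex)⟩
  simpa using Nat.find_min hex (m := j) (by omega)

lemma exists_separation_codedDigit (b : ℕ → Bool) {s t : ℝ} (hs : s ∈ Ico (0 : ℝ) 1)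
    (ht : t ∈ Ico (0 : ℝ) 1) (hst : s < t) : ∃ j : ℕ, t - s ≤ 1 / 4 ^ (j ^ 2) ∧
      1 / 4 ^ (j ^ 2 + 3 * j + 3) ≤
        expansionPoint (codedDigit b t) - expansionPoint (codedDigit b s) := by
  obtain ⟨j, hj, hj'⟩ := exists_first_floor_lt hs ht hst
  refine ⟨j, ?_, ?_⟩
  · have h₁ := Nat.lt_floor_add_one (4 ^ (j ^ 2) * t)
    have h₂ := Nat.floor_le (a := 4 ^ (j ^ 2) * s) (mul_nonneg (by positivity) hs.1)
    rw [hj] at h₂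
    rw [le_div_iff₀ (by positivity)]
    linarith
  · have hd : baseDigit s j < baseDigit t j := by
      have h₁ := Nat.div_add_mod ⌊4 ^ ((j + 1) ^ 2) * s⌋₊ (4 ^ (2 * j + 1))
      have h₂ := Nat.div_add_mod ⌊4 ^ ((j + 1) ^ 2) * t⌋₊ (4 ^ (2 * j + 1))
      rw [floor_succ_div] at h₁ h₂
      rw [hj] at h₁
      unfold baseDigit
      omega
    have hn : expansionNumer (codedDigit b s) (j + 1) + 1 ≤
        expansionNumer (codedDigit b t) (j + 1) := by
      rw [expansionNumer, expansionNumer, expansionNumer_codedDigit_eq b hj, codedDigit,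
        codedDigit]
      omega
    have hn' : (expansionNumer (codedDigit b s) (j + 1) + 1 : ℝ) ≤
        expansionNumer (codedDigit b t) (j + 1) := by exact_mod_cast hn
    have h₁ := (expansionPoint_mem (codedDigit_succ_le b s) (j + 1)).2
    have h₂ := (expansionPoint_mem (codedDigit_succ_le b t) (j + 1)).1
    calc (1 : ℝ) / 4 ^ (j ^ 2 + 3 * j + 3) = (1 / 4) / 4 ^ ((j + 1) ^ 2 + (j + 1)) := by
          rw [show j ^ 2 + 3 * j + 3 = (j + 1) ^ 2 + (j + 1) + 1 by ring, pow_succ]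
          field_simp
      _ ≤ (expansionNumer (codedDigit b t) (j + 1) : ℝ) / 4 ^ ((j + 1) ^ 2 + (j + 1)) -
          (expansionNumer (codedDigit b s) (j + 1) + 3 / 4) / 4 ^ ((j + 1) ^ 2 + (j + 1)) := by
          rw [← sub_div]
          gcongr
          linarith
      _ ≤ _ := by linarith

lemma exists_const_mul_rpow_le {r : ℝ} (hr₀ : 0 < r) (hr₁ : r < 1) :
    ∃ C : ℝ≥0, ∀ j : ℕ, (1 : ℝ) / 4 ^ (j ^ 2) ≤ C * (1 / 4 ^ (j ^ 2 + 3 * j + 3)) ^ r := by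
  refine ⟨(4 : ℝ≥0) ^ (3 + 3 / (1 - r)), fun j => ?_⟩
  have hr : 0 < 1 - r := by linarith
  push_cast
  rw [← Real.rpow_natCast, ← Real.rpow_natCast, one_div, one_div,
    ← Real.rpow_neg (by norm_num), ← Real.rpow_neg (by norm_num), ← Real.rpow_mul (by norm_num),
    ← Real.rpow_add (by norm_num)]
  refine Real.rpow_le_rpow_of_exponent_le (by norm_num) ?_
  push_cast
  have hj : (0 : ℝ) ≤ j := by positivity
  set w := 3 / (1 - r) with hw
  have hw' : w * (1 - r) = 3 := div_mul_cancel₀ _ hr.ne'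
  have : 0 ≤ (1 - r) * (j - w / 2) ^ 2 := by positivity
  have hw0 : 0 < w := by positivity
  nlinarith [mul_nonneg hj hr.le]

/-- If `ψ` does not contract distances by more than a power arbitrarily close to `1`, then the
image of a set of Hausdorff dimension one has Hausdorff dimension at least one. -/
lemma one_le_dimH_image {s : Set ℝ} {ψ : ℝ → ℝ} (hs : dimH s = 1)
    (h : ∀ r : ℝ≥0, 0 < r → r < 1 → ∃ C : ℝ≥0, ∀ x ∈ s, ∀ y ∈ s,
      dist x y ≤ C * dist (ψ x) (ψ y) ^ (r : ℝ)) : 1 ≤ dimH (ψ '' s) := by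
  refine le_of_forall_lt fun a ha => ?_
  obtain ⟨r, har, hr₁⟩ := ENNReal.lt_iff_exists_nnreal_btwn.1 ha
  have hr₁ : r < 1 := by exact_mod_cast hr₁
  have hr₀ : 0 < r := by exact_mod_cast (zero_le.trans_lt har)
  refine har.trans_le ?_
  obtain ⟨C, hC⟩ := h r hr₀ hr₁
  have hinj : InjOn ψ s := by
    intro x hx y hy hxy
    have := hC x hx y hy
    rw [hxy, dist_self, Real.zero_rpow (by exact_mod_cast hr₀.ne'), mul_zero] at this
    exact dist_le_zero.1 this
  have hH : HolderOnWith C r (Function.invFunOn ψ s) (ψ '' s) := by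
    rintro _ ⟨x, hx, rfl⟩ _ ⟨y, hy, rfl⟩
    rw [hinj.leftInvOn_invFunOn hx, hinj.leftInvOn_invFunOn hy, edist_nndist, edist_nndist,
      ← ENNReal.coe_rpow_of_nonneg _ r.coe_nonneg]
    exact_mod_cast hC x hx y hy
  have hle := hH.dimH_image_le hr₀
  rw [hinj.leftInvOn_invFunOn.image_image, hs] at hle
  rwa [ENNReal.le_div_iff_mul_le (Or.inl (by exact_mod_cast hr₀.ne')) (Or.inl (by simp)),
    one_mul] at hle

lemma one_le_dimH_expansionPoint_image (b : ℕ → Bool) :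
    1 ≤ dimH ((fun t => expansionPoint (codedDigit b t)) '' Ico (0 : ℝ) 1) := by
  refine one_le_dimH_image ?_ fun r hr₀ hr₁ => ?_
  · simpa using Real.dimH_of_nonempty_interior (s := Ico (0 : ℝ) 1) (by simp)
  · obtain ⟨C, hC⟩ := exists_const_mul_rpow_le (r := r) (by exact_mod_cast hr₀)
      (by exact_mod_cast hr₁)
    refine ⟨C, fun x hx y hy => ?_⟩
    wlog hxy : x < y generalizing x y
    · rcases (not_lt.1 hxy).eq_or_lt with h | h
      · rw [h, dist_self]
        positivity
      · rw [dist_comm x, dist_comm (expansionPoint _)]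
        exact this y hy x hx h
    obtain ⟨j, h₁, h₂⟩ := exists_separation_codedDigit b hx hy hxy
    rw [dist_comm x, dist_comm (expansionPoint _), Real.dist_eq, abs_of_pos (sub_pos.2 hxy)]
    refine (h₁.trans (hC j)).trans ?_
    gcongr
    exact h₂.trans (le_abs_self _)

lemma dimH_lacunarySeries_level (k : ℕ) (b : ℕ → Bool) :
    dimH (Ioo (-2 : ℝ) 2 ∩ lacunarySeries k ⁻¹' {lacunaryValue k b}) = 1 := by
  refine le_antisymm ((dimH_mono (subset_univ _)).trans_eq Real.dimH_univ)
    ((one_le_dimH_expansionPoint_image b).trans (dimH_mono ?_))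
  rintro _ ⟨t, -, rfl⟩
  have h := expansionPoint_mem (codedDigit_succ_le b t) 0
  norm_num [expansionNumer] at h
  exact ⟨⟨by simp only; linarith [h.1], by simp only; linarith [h.2]⟩,
    lacunarySeries_expansionPoint k b t⟩

/-- For `k ≥ 1` there is a `C^k` function `f` on `(-2, 2)` having an uncountable
family of level sets of Hausdorff dimension `1`. -/
theorem exists_contDiffOn_uncountable_dim_one_level_values (k : ℕ) (hk : 1 ≤ k) :
    ∃ f : ℝ → ℝ, ContDiffOn ℝ k f (Set.Ioo (-2 : ℝ) 2) ∧
      ¬ {y : ℝ | dimH (Set.Ioo (-2 : ℝ) 2 ∩ f ⁻¹' {y}) = 1}.Countable := by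
  refine ⟨lacunarySeries k, (contDiff_lacunarySeries k).contDiffOn, fun h => ?_⟩
  have hr : (range (lacunaryValue k)).Countable :=
    h.mono (range_subset_iff.2 (dimH_lacunarySeries_level k))
  have : Countable (ℕ → Bool) := countable_univ_iff.1
    (countable_of_injective_of_countable_image (lacunaryValue_injective k).injOn
      (by rwa [image_univ]))
  obtain ⟨g, hg⟩ := exists_surjective_nat (ℕ → Bool)
  obtain ⟨n, hn⟩ := hg fun n => !g n n
  simpa using congrFun hn n
end
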